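/- For every $q > 1$ and every $\varepsilon > 0$, the Muckenhoupt class $A_q$ is strictly contained in the restricted class $A_q^{\mathcal{R}}$, and $A_q^{\mathcal{R}} \subseteq A_{q+\varepsilon}$. -/

import Mathlib

open MeasureTheory ENNReal Set Filter

noncomputable section

/-- The measure with density `w` with respect to the ambient volume. -/
def wMeasure {α : Type*} [MeasureSpace α] (w : α → ℝ) : Measure α :=
  (volume : Measure α).withDensity fun x => ENNReal.ofReal (w x)

/-- The weak Lorentz `L^{q,∞}(μ)` quasi-norm. -/
def wLorentz {α E : Type*} [MeasurableSpace α] [Norm E] (q : ℝ) (μ : Measure α)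
    (g : α → E) : ℝ≥0∞ :=
  ⨆ (t : ℝ) (_ : 0 < t), ENNReal.ofReal t * μ {x | t < ‖g x‖} ^ (1 / q)

/-- The weak Lorentz `L^{q,∞}(μ)` quasi-norm, for `ℝ≥0∞`-valued functions. -/
def wLorentzE {α : Type*} [MeasurableSpace α] (q : ℝ) (μ : Measure α)
    (g : α → ℝ≥0∞) : ℝ≥0∞ :=
  ⨆ (t : ℝ) (_ : 0 < t), ENNReal.ofReal t * μ {x | ENNReal.ofReal t < g x} ^ (1 / q)

/-- The Lorentz `L^{p,r}(μ)` quasi-norm (computed via the distribution function). -/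
def lorentz {α E : Type*} [MeasurableSpace α] [Norm E] (p r : ℝ) (μ : Measure α)
    (g : α → E) : ℝ≥0∞ :=
  (∫⁻ t in Set.Ioi (0 : ℝ), ENNReal.ofReal (t ^ (r - 1)) * μ {x | t < ‖g x‖} ^ (r / p)) ^ (1 / r)

/-- A weight: a locally integrable, a.e. positive function. -/
def IsWeight {α : Type*} [MeasureSpace α] [TopologicalSpace α] (w : α → ℝ) : Prop :=
  LocallyIntegrable w volume ∧ ∀ᵐ x : α ∂volume, 0 < w x

abbrev Rn (n : ℕ) : Type := Fin n → ℝ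

/-- The axis-parallel closed cube with center `c` and half side-length `r`. -/
def cube {n : ℕ} (c : Rn n) (r : ℝ) : Set (Rn n) := {x | ∀ i, |x i - c i| ≤ r}

/-- The Hardy–Littlewood maximal operator over cubes. -/
def maxOp {n : ℕ} (f : Rn n → ℝ) (x : Rn n) : ℝ≥0∞ :=
  ⨆ (c : Rn n) (r : ℝ) (_ : 0 < r) (_ : x ∈ cube c r),
    (∫⁻ y in cube c r, ENNReal.ofReal |f y|) / volume (cube c r)

/-- The `A₁` constant: the least `C` with `Mu ≤ C u` a.e. -/
def A1Const {n : ℕ} (u : Rn n → ℝ) : ℝ≥0∞ :=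
  sInf {C : ℝ≥0∞ | ∀ᵐ x : Rn n ∂volume, maxOp u x ≤ C * ENNReal.ofReal (u x)}

def MemA1 {n : ℕ} (u : Rn n → ℝ) : Prop := IsWeight u ∧ A1Const u < ⊤

/-- The `RH∞` constant `sup_Q (ess sup_Q v) |Q| / v(Q)`. -/
def RHinfConst {n : ℕ} (v : Rn n → ℝ) : ℝ≥0∞ :=
  ⨆ (c : Rn n) (r : ℝ) (_ : 0 < r),
    essSup (fun x => ENNReal.ofReal (v x)) (volume.restrict (cube c r)) * volume (cube c r)
      / wMeasure v (cube c r)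

/-- The Fujii–Wilson `A∞` constant. -/
def FWConst {n : ℕ} (w : Rn n → ℝ) : ℝ≥0∞ :=
  ⨆ (c : Rn n) (r : ℝ) (_ : 0 < r),
    (∫⁻ x in cube c r, maxOp ((cube c r).indicator w) x) / wMeasure w (cube c r)

/-- The Muckenhoupt `A_q` constant, `q > 1`. -/
def AqConst {n : ℕ} (q : ℝ) (w : Rn n → ℝ) : ℝ≥0∞ :=
  ⨆ (c : Rn n) (r : ℝ) (_ : 0 < r),
    (wMeasure w (cube c r) / volume (cube c r)) *
      ((∫⁻ x in cube c r, ENNReal.ofReal (w x ^ (1 - q / (q - 1)))) / volume (cube c r)) ^ (q - 1)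

/-- Membership in `A∞ = ⋃_{q>1} A_q`. -/
def MemAinf {n : ℕ} (w : Rn n → ℝ) : Prop := ∃ q : ℝ, 1 < q ∧ AqConst q w < ⊤

/-- The restricted `A_q^𝓡` constant. -/
def AqRConst {n : ℕ} (q : ℝ) (w : Rn n → ℝ) : ℝ≥0∞ :=
  ⨆ (c : Rn n) (r : ℝ) (_ : 0 < r) (E : Set (Rn n)) (_ : MeasurableSet E)
    (_ : E ⊆ cube c r) (_ : 0 < volume E),
    volume E / volume (cube c r) * (wMeasure w (cube c r) / wMeasure w E) ^ (1 / q)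

/-- The constant `[w]_{RH∞¹} = inf {[u]_{A₁}[v]_{RH∞} : w = uv}`. -/
def RH1Const {n : ℕ} (w : Rn n → ℝ) : ℝ≥0∞ :=
  sInf {C : ℝ≥0∞ | ∃ u v : Rn n → ℝ, (∀ x, w x = u x * v x) ∧ MemA1 u ∧ IsWeight v ∧
    RHinfConst v < ⊤ ∧ C = A1Const u * RHinfConst v}

/-- `S f = (M(|Tf|^{1/2}))²`. -/
def Sop {n : ℕ} (T : (Rn n → ℝ) → Rn n → ℝ) (f : Rn n → ℝ) (x : Rn n) : ℝ≥0∞ :=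
  maxOp (fun y => |T f y| ^ ((2 : ℝ)⁻¹)) x ^ (2 : ℝ)

/-- Condition (C): for some `p₀` and increasing `φ`,
`∫ (Sf)^{p₀} w ≤ φ([w]_{A∞}) ∫ (Mf)^{p₀} w` for all `w ∈ A∞`. -/
def ConditionC {n : ℕ} (T : (Rn n → ℝ) → Rn n → ℝ) : Prop :=
  ∃ p0 : ℝ, 0 < p0 ∧ ∃ φ : ℝ≥0∞ → ℝ≥0∞, Monotone φ ∧
    ∀ w : Rn n → ℝ, IsWeight w → MemAinf w → ∀ f : Rn n → ℝ, Measurable f →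
      (∫⁻ x, Sop T f x ^ p0 * ENNReal.ofReal (w x)) < ⊤ →
      (∫⁻ x, Sop T f x ^ p0 * ENNReal.ofReal (w x)) ≤
        φ (FWConst w) * ∫⁻ x, maxOp f x ^ p0 * ENNReal.ofReal (w x)


lemma cube_eq_closedBall {n : ℕ} (c : Rn n) {r : ℝ} (hr : 0 < r) :
    cube c r = Metric.closedBall c r := by
  ext x
  rw [Metric.mem_closedBall, dist_pi_le_iff hr.le]
  simp [cube, Real.dist_eq]

lemma isCompact_cube {n : ℕ} (c : Rn n) {r : ℝ} (hr : 0 < r) : IsCompact (cube c r) := by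
  rw [cube_eq_closedBall c hr]
  exact isCompact_closedBall c r

lemma measurableSet_cube {n : ℕ} (c : Rn n) {r : ℝ} (hr : 0 < r) : MeasurableSet (cube c r) :=
  (isCompact_cube c hr).measurableSet

lemma volume_cube {n : ℕ} (c : Rn n) {r : ℝ} (hr : 0 < r) :
    volume (cube c r) = ENNReal.ofReal ((2 * r) ^ n) := by
  rw [cube_eq_closedBall c hr, Real.volume_pi_closedBall c hr.le, Fintype.card_fin]

lemma volume_cube_ne_zero {n : ℕ} (c : Rn n) {r : ℝ} (hr : 0 < r) : volume (cube c r) ≠ 0 := by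
  rw [volume_cube c hr]
  exact (ENNReal.ofReal_pos.2 (by positivity)).ne'

lemma volume_cube_ne_top {n : ℕ} (c : Rn n) {r : ℝ} (hr : 0 < r) : volume (cube c r) ≠ ⊤ :=
  (isCompact_cube c hr).measure_lt_top.ne

lemma IsWeight.aemeasurable {n : ℕ} {w : Rn n → ℝ} (hw : IsWeight w) : AEMeasurable w volume :=
  hw.1.aestronglyMeasurable.aemeasurable

lemma IsWeight.wMeasure_ne_zero {n : ℕ} {w : Rn n → ℝ} (hw : IsWeight w) {E : Set (Rn n)}
    (hE : volume E ≠ 0) : wMeasure w E ≠ 0 := by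
  have hac : (volume : Measure (Rn n)) ≪ wMeasure w :=
    withDensity_absolutelyContinuous' hw.aemeasurable.ennreal_ofReal
      (hw.2.mono fun x hx => (ENNReal.ofReal_pos.2 hx).ne')
  exact fun h => hE (hac h)

lemma IsWeight.wMeasure_cube_ne_top {n : ℕ} {w : Rn n → ℝ} (hw : IsWeight w) (c : Rn n) {r : ℝ}
    (hr : 0 < r) : wMeasure w (cube c r) ≠ ⊤ := by
  rw [wMeasure, withDensity_apply _ (measurableSet_cube c hr)]
  refine ((lintegral_mono fun x => ?_).trans_lt
    (hw.1.integrableOn_isCompact (isCompact_cube c hr)).2).ne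
  exact Real.ofReal_le_enorm (w x)

/-- The inequality `(|E|/|Q|) (w(Q)/w(E))^{1/q} ≤ C`, cleared of denominators. -/
lemma restricted_ratio_le_iff {q : ℝ} (hq : 0 < q) {v V A B C : ℝ≥0∞} (hV : V ≠ 0) (hV' : V ≠ ⊤)
    (hB : B ≠ 0) (hB' : B ≠ ⊤) :
    v / V * (A / B) ^ (1 / q) ≤ C ↔ v ^ q * A ≤ C ^ q * (V ^ q * B) := by
  have hVq : V ^ q ≠ 0 := (ENNReal.rpow_pos (pos_iff_ne_zero.2 hV) hV').ne'
  have hVq' : V ^ q ≠ ⊤ := ENNReal.rpow_ne_top_of_nonneg hq.le hV'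
  rw [← ENNReal.rpow_le_rpow_iff hq, ENNReal.mul_rpow_of_nonneg _ _ hq.le, ← ENNReal.rpow_mul,
    one_div_mul_cancel hq.ne', ENNReal.rpow_one, ENNReal.div_rpow_of_nonneg _ _ hq.le,
    ← ENNReal.div_le_iff (mul_ne_zero hVq hB) (ENNReal.mul_ne_top hVq' hB')]
  rw [div_eq_mul_inv, div_eq_mul_inv, div_eq_mul_inv,
    ENNReal.mul_inv (Or.inl hVq) (Or.inl hVq'), mul_mul_mul_comm]

lemma AqRConst_lt_top_of_bound {n : ℕ} {q : ℝ} (hq : 0 < q) {w : Rn n → ℝ} (hw : IsWeight w)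
    {K : ℝ≥0∞} (hK : K ≠ ⊤)
    (h : ∀ (c : Rn n) (r : ℝ), 0 < r → ∀ E : Set (Rn n), MeasurableSet E → E ⊆ cube c r →
      0 < volume E →
      volume E ^ q * wMeasure w (cube c r) ≤ K * (volume (cube c r) ^ q * wMeasure w E)) :
    AqRConst q w < ⊤ := by
  refine lt_of_le_of_lt (b := K ^ (1 / q)) ?_
    (ENNReal.rpow_lt_top_of_nonneg (by positivity) hK)
  refine iSup_le fun c => iSup_le fun r => iSup_le fun hr => iSup_le fun E => iSup_le fun hE =>
    iSup_le fun hEQ => iSup_le fun hE0 => ?_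
  rw [restricted_ratio_le_iff hq (volume_cube_ne_zero c hr) (volume_cube_ne_top c hr)
    (hw.wMeasure_ne_zero hE0.ne')
    (ne_top_of_le_ne_top (hw.wMeasure_cube_ne_top c hr) (measure_mono hEQ)), ← ENNReal.rpow_mul,
    one_div_mul_cancel hq.ne', ENNReal.rpow_one]
  exact h c r hr E hE hEQ hE0

lemma bound_of_AqRConst {n : ℕ} {q : ℝ} (hq : 0 < q) {w : Rn n → ℝ} (hw : IsWeight w)
    (c : Rn n) {r : ℝ} (hr : 0 < r) {E : Set (Rn n)} (hE : MeasurableSet E) (hEQ : E ⊆ cube c r)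
    (hE0 : 0 < volume E) :
    volume E ^ q * wMeasure w (cube c r) ≤
      AqRConst q w ^ q * (volume (cube c r) ^ q * wMeasure w E) := by
  rw [← restricted_ratio_le_iff hq (volume_cube_ne_zero c hr) (volume_cube_ne_top c hr)
    (hw.wMeasure_ne_zero hE0.ne')
    (ne_top_of_le_ne_top (hw.wMeasure_cube_ne_top c hr) (measure_mono hEQ))]
  exact le_iSup_of_le c <| le_iSup_of_le r <| le_iSup_of_le hr <| le_iSup_of_le E <|
    le_iSup_of_le hE <| le_iSup_of_le hEQ <| le_iSup_of_le hE0 le_rfl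

/-- Hölder's inequality: `|E|^q ≤ w(E) (∫_E w^{1-q'})^{q-1}`. -/
lemma volume_rpow_le {n : ℕ} {q : ℝ} (hq : 1 < q) {w : Rn n → ℝ} (hw : IsWeight w)
    {E : Set (Rn n)} (hE : MeasurableSet E) :
    volume E ^ q ≤ wMeasure w E *
      (∫⁻ x in E, ENNReal.ofReal (w x ^ (1 - q / (q - 1)))) ^ (q - 1) := by
  have hq0 : 0 < q := by linarith
  have hq1 : 0 < q - 1 := by linarith
  have hpq : q.HolderConjugate (q / (q - 1)) := Real.HolderConjugate.conjExponent hq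
  have hm : AEMeasurable w (volume.restrict E) := hw.aemeasurable.restrict
  have hpos : ∀ᵐ x ∂(volume.restrict E), 0 < w x := ae_restrict_of_ae hw.2
  have key := ENNReal.lintegral_mul_le_Lp_mul_Lq (volume.restrict E) hpq
    (f := fun x => ENNReal.ofReal (w x ^ (1 / q)))
    (g := fun x => ENNReal.ofReal (w x ^ (-(1 / q))))
    (hm.pow_const _).ennreal_ofReal (hm.pow_const _).ennreal_ofReal
  have e1 : ∫⁻ x in E, ((fun x => ENNReal.ofReal (w x ^ (1 / q))) *
      fun x => ENNReal.ofReal (w x ^ (-(1 / q)))) x = volume E := by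
    rw [← setLIntegral_one]
    refine lintegral_congr_ae (hpos.mono fun x hx => ?_)
    simp only [Pi.mul_apply]
    rw [← ENNReal.ofReal_mul (by positivity), ← Real.rpow_add hx]
    simp
  have e2 : ∫⁻ x in E, ENNReal.ofReal (w x ^ (1 / q)) ^ q = wMeasure w E := by
    rw [wMeasure, withDensity_apply _ hE]
    refine lintegral_congr_ae (hpos.mono fun x hx => ?_)
    simp only
    rw [ENNReal.ofReal_rpow_of_pos (by positivity), ← Real.rpow_mul hx.le,
      one_div_mul_cancel hq0.ne', Real.rpow_one]
  have e3 : ∫⁻ x in E, ENNReal.ofReal (w x ^ (-(1 / q))) ^ (q / (q - 1)) =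
      ∫⁻ x in E, ENNReal.ofReal (w x ^ (1 - q / (q - 1))) := by
    refine lintegral_congr_ae (hpos.mono fun x hx => ?_)
    simp only
    rw [ENNReal.ofReal_rpow_of_pos (by positivity), ← Real.rpow_mul hx.le]
    congr 2
    field_simp
    ring
  rw [e1, e2, e3] at key
  calc volume E ^ q ≤ _ := ENNReal.rpow_le_rpow key hq0.le
    _ = _ := by
      rw [ENNReal.mul_rpow_of_nonneg _ _ hq0.le, ← ENNReal.rpow_mul, ← ENNReal.rpow_mul,
        one_div_mul_cancel hq0.ne', ENNReal.rpow_one]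
      congr 2
      field_simp

lemma AqRConst_lt_top_of_AqConst {n : ℕ} {q : ℝ} (hq : 1 < q) {w : Rn n → ℝ} (hw : IsWeight w)
    (h : AqConst q w < ⊤) : AqRConst q w < ⊤ := by
  have hq0 : 0 < q := by linarith
  have hq1 : 0 < q - 1 := by linarith
  refine AqRConst_lt_top_of_bound hq0 hw h.ne fun c r hr E hE hEQ hE0 => ?_
  set V := volume (cube c r)
  set S := ∫⁻ x in cube c r, ENNReal.ofReal (w x ^ (1 - q / (q - 1)))
  have hV : V ≠ 0 := volume_cube_ne_zero c hr
  have hV' : V ≠ ⊤ := volume_cube_ne_top c hr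
  have hVq : V ^ (q - 1) ≠ 0 := (ENNReal.rpow_pos (pos_iff_ne_zero.2 hV) hV').ne'
  have hVq' : V ^ (q - 1) ≠ ⊤ := ENNReal.rpow_ne_top_of_nonneg hq1.le hV'
  have hA : wMeasure w (cube c r) / V * (S / V) ^ (q - 1) ≤ AqConst q w :=
    le_iSup_of_le c <| le_iSup_of_le r <| le_iSup_of_le hr le_rfl
  have hsplit : V ^ q = V * V ^ (q - 1) := by
    conv_lhs => rw [show q = 1 + (q - 1) by ring, ENNReal.rpow_add _ _ hV hV', ENNReal.rpow_one]
  have hA' : wMeasure w (cube c r) * S ^ (q - 1) ≤ AqConst q w * V ^ q := by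
    rw [hsplit, ← ENNReal.div_le_iff (mul_ne_zero hV hVq) (ENNReal.mul_ne_top hV' hVq')]
    rw [ENNReal.div_rpow_of_nonneg _ _ hq1.le] at hA
    rwa [div_eq_mul_inv, ENNReal.mul_inv (Or.inl hV) (Or.inl hV'), mul_mul_mul_comm]
  calc volume E ^ q * wMeasure w (cube c r)
      ≤ wMeasure w E * S ^ (q - 1) * wMeasure w (cube c r) := by
        gcongr
        refine (volume_rpow_le hq hw hE).trans ?_
        gcongr
        exact lintegral_mono_set hEQ
    _ = wMeasure w E * (wMeasure w (cube c r) * S ^ (q - 1)) := by ring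
    _ ≤ wMeasure w E * (AqConst q w * V ^ q) := by gcongr
    _ = AqConst q w * (V ^ q * wMeasure w E) := by ring

/-- A quantitative embedding of weak `L^a` into `L^s`, `s < a`, on a finite measure space. -/
lemma lintegral_rpow_le_of_weak {α : Type*} [MeasurableSpace α] (μ : Measure α) {f : α → ℝ}
    (hf0 : 0 ≤ᵐ[μ] f) (hf : AEMeasurable f μ) {V T a s : ℝ} (hV : 0 ≤ V) (hT : 0 < T)
    (hs : 0 < s) (hsa : s < a) (huniv : μ Set.univ ≤ ENNReal.ofReal V)
    (h : ∀ t, 0 < t → μ {x | t < f x} ≤ ENNReal.ofReal (V * (T / t) ^ a)) :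
    ∫⁻ x, ENNReal.ofReal (f x ^ s) ∂μ ≤ ENNReal.ofReal (V * (T ^ s * (a / (a - s)))) := by
  have has : 0 < a - s := by linarith
  rw [lintegral_rpow_eq_lintegral_meas_lt_mul μ hf0 hf hs, ← Ioc_union_Ioi_eq_Ioi hT.le]
  have h1 : ∫⁻ t in Ioc 0 T, μ {x | t < f x} * ENNReal.ofReal (t ^ (s - 1)) ≤
      ENNReal.ofReal (V * (T ^ s / s)) := by
    have hint : IntegrableOn (fun t : ℝ => V * t ^ (s - 1)) (Ioc 0 T) := by
      refine Integrable.const_mul ?_ V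
      rw [← IntegrableOn, ← intervalIntegrable_iff_integrableOn_Ioc_of_le hT.le]
      exact intervalIntegral.intervalIntegrable_rpow' (by linarith)
    have hval : ∫ t in Ioc 0 T, V * t ^ (s - 1) = V * (T ^ s / s) := by
      rw [integral_const_mul, ← intervalIntegral.integral_of_le hT.le,
        integral_rpow (Or.inl (by linarith))]
      simp [Real.zero_rpow hs.ne']
    rw [← hval, ofReal_integral_eq_lintegral_ofReal hint
      ((ae_restrict_mem measurableSet_Ioc).mono fun t ht =>
        mul_nonneg hV (Real.rpow_nonneg ht.1.le _))]
    refine lintegral_mono fun t => ?_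
    rw [ENNReal.ofReal_mul hV]
    gcongr
    exact (measure_mono (subset_univ _)).trans huniv
  have h2 : ∫⁻ t in Ioi T, μ {x | t < f x} * ENNReal.ofReal (t ^ (s - 1)) ≤
      ENNReal.ofReal (V * (T ^ s / (a - s))) := by
    have hint : IntegrableOn (fun t : ℝ => V * T ^ a * t ^ (s - 1 - a)) (Ioi T) :=
      (integrableOn_Ioi_rpow_of_lt (by linarith) hT).const_mul _
    have hval : ∫ t in Ioi T, V * T ^ a * t ^ (s - 1 - a) = V * (T ^ s / (a - s)) := by
      rw [integral_const_mul, integral_Ioi_rpow_of_lt (by linarith) hT]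
      have e : T ^ s = T ^ a * T ^ (s - 1 - a + 1) := by
        rw [← Real.rpow_add hT]; congr 1; ring
      rw [e, show s - 1 - a + 1 = -(a - s) by ring]
      field_simp
    rw [← hval, ofReal_integral_eq_lintegral_ofReal hint
      ((ae_restrict_mem measurableSet_Ioi).mono fun t ht => by
        have : 0 < t := hT.trans ht
        positivity)]
    refine setLIntegral_mono' measurableSet_Ioi fun t ht => ?_
    have ht0 : 0 < t := hT.trans ht
    calc μ {x | t < f x} * ENNReal.ofReal (t ^ (s - 1))
        ≤ ENNReal.ofReal (V * (T / t) ^ a) * ENNReal.ofReal (t ^ (s - 1)) := by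
          gcongr
          exact h t ht0
      _ = ENNReal.ofReal (V * T ^ a * t ^ (s - 1 - a)) := by
          rw [← ENNReal.ofReal_mul (by positivity), Real.div_rpow hT.le ht0.le,
            Real.rpow_sub ht0 (s - 1) a]
          congr 1
          field_simp
  calc _ ≤ ENNReal.ofReal s * (ENNReal.ofReal (V * (T ^ s / s)) +
        ENNReal.ofReal (V * (T ^ s / (a - s)))) := by
        gcongr
        exact (lintegral_union_le _ _ _).trans (add_le_add h1 h2)
    _ = _ := by
        rw [← ENNReal.ofReal_add (by positivity) (by positivity), ← ENNReal.ofReal_mul hs.le]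
        congr 1
        field_simp
        ring

/-- The restricted condition puts `w⁻¹` in weak `L^{1/(q-1)}` on every cube. -/
lemma volume_superlevel_inv_le {n : ℕ} {q : ℝ} (hq : 1 < q) {w g : Rn n → ℝ} (hw : IsWeight w)
    (hg : Measurable g) (hwg : w =ᵐ[volume] g) {C : ℝ} (hC : 0 < C)
    (hwC : AqRConst q w ≤ ENNReal.ofReal C) (c : Rn n) {r : ℝ} (hr : 0 < r) {t : ℝ} (ht : 0 < t) :
    volume.restrict (cube c r) {x | t < (g x)⁻¹} ≤
      ENNReal.ofReal (volume.real (cube c r) *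
        (C ^ q * volume.real (cube c r) / (wMeasure w).real (cube c r) / t) ^ (1 / (q - 1))) := by
  have hq0 : 0 < q := by linarith
  have hq1 : 0 < q - 1 := by linarith
  have hEm' : MeasurableSet {x | t < (g x)⁻¹} := measurableSet_lt measurable_const hg.inv
  rw [Measure.restrict_apply hEm']
  set E := {x | t < (g x)⁻¹} ∩ cube c r with hEdef
  have hEm : MeasurableSet E := hEm'.inter (measurableSet_cube c hr)
  have hEQ : E ⊆ cube c r := inter_subset_right
  have hEt : volume E ≠ ⊤ := ne_top_of_le_ne_top (volume_cube_ne_top c hr) (measure_mono hEQ)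
  rcases eq_or_ne (volume E) 0 with h0 | h0
  · rw [h0]; exact zero_le
  have hWE : wMeasure w E ≤ ENNReal.ofReal t⁻¹ * volume E := by
    rw [wMeasure, withDensity_apply _ hEm, ← setLIntegral_const]
    refine lintegral_mono_ae ?_
    filter_upwards [ae_restrict_of_ae hwg, ae_restrict_mem hEm] with x hx hxE
    rw [hx]
    have h1 : t < (g x)⁻¹ := hxE.1
    have h2 : 0 < g x := inv_pos.1 (ht.trans h1)
    exact ENNReal.ofReal_le_ofReal ((lt_inv_comm₀ ht h2).1 h1).le
  have key := bound_of_AqRConst hq0 hw c hr hEm hEQ (pos_iff_ne_zero.2 h0)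
  have hQ0 := volume_cube_ne_zero c hr
  have hQt := volume_cube_ne_top c hr
  have hW0 := hw.wMeasure_ne_zero hQ0
  have hWt := hw.wMeasure_cube_ne_top c hr
  have hv : 0 < volume.real E := ENNReal.toReal_pos h0 hEt
  have hV : 0 < volume.real (cube c r) := ENNReal.toReal_pos hQ0 hQt
  have hW : 0 < (wMeasure w).real (cube c r) := ENNReal.toReal_pos hW0 hWt
  have key2 : volume E ^ q * wMeasure w (cube c r) ≤
      ENNReal.ofReal C ^ q * (volume (cube c r) ^ q * (ENNReal.ofReal t⁻¹ * volume E)) :=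
    key.trans (by gcongr)
  rw [← ofReal_measureReal hEt, ← ofReal_measureReal hQt, ← ofReal_measureReal hWt] at key2
  set v := volume.real E
  set V := volume.real (cube c r)
  set W := (wMeasure w).real (cube c r)
  rw [ENNReal.ofReal_rpow_of_pos hv, ENNReal.ofReal_rpow_of_pos hV, ENNReal.ofReal_rpow_of_pos hC,
    ← ENNReal.ofReal_mul (by positivity), ← ENNReal.ofReal_mul (by positivity),
    ← ENNReal.ofReal_mul (by positivity), ← ENNReal.ofReal_mul (by positivity),
    ENNReal.ofReal_le_ofReal_iff (by positivity)] at key2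
  rw [← ofReal_measureReal hEt]
  refine ENNReal.ofReal_le_ofReal ?_
  change v ≤ _
  have hratio : (v / V) ^ (q - 1) ≤ C ^ q * V / W / t := by
    rw [Real.div_rpow hv.le hV.le, Real.rpow_sub_one hv.ne', Real.rpow_sub_one hV.ne',
      le_div_iff₀ ht, le_div_iff₀ hW]
    have hVq : 0 < V ^ q := by positivity
    calc v ^ q / v / (V ^ q / V) * t * W = (v ^ q * W) * (t * V / (v * V ^ q)) := by
          field_simp
      _ ≤ (C ^ q * (V ^ q * (t⁻¹ * v))) * (t * V / (v * V ^ q)) := by gcongr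
      _ = C ^ q * V := by field_simp
  rw [← div_le_iff₀' hV]
  calc v / V = ((v / V) ^ (q - 1)) ^ (1 / (q - 1)) := by
        rw [← Real.rpow_mul (by positivity), mul_one_div_cancel hq1.ne', Real.rpow_one]
    _ ≤ _ := by gcongr

lemma AqConst_lt_top_of_AqRConst {n : ℕ} {q p : ℝ} (hq : 1 < q) (hqp : q < p) {w : Rn n → ℝ}
    (hw : IsWeight w) (h : AqRConst q w < ⊤) : AqConst p w < ⊤ := by
  have hq1 : 0 < q - 1 := by linarith
  have hp1 : 0 < p - 1 := by linarith
  obtain ⟨C, hC, hwC⟩ : ∃ C : ℝ, 0 < C ∧ AqRConst q w ≤ ENNReal.ofReal C :=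
    ⟨(AqRConst q w).toReal + 1, by positivity,
      (ENNReal.le_ofReal_iff_toReal_le h.ne (by positivity)).2 (by linarith)⟩
  set a := 1 / (q - 1)
  set s := 1 / (p - 1) with hs
  have hs0 : 0 < s := by positivity
  have hsa : s < a := one_div_lt_one_div_of_lt hq1 (by linarith)
  have has : 0 < a - s := by linarith
  have ha0 : 0 < a := by positivity
  have hg : Measurable (hw.aemeasurable.mk w) := hw.aemeasurable.measurable_mk
  have hwg := hw.aemeasurable.ae_eq_mk
  set g := hw.aemeasurable.mk w
  have hgpos : ∀ᵐ x, 0 < g x := by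
    filter_upwards [hw.2, hwg] with x hx hx'
    rwa [← hx']
  refine lt_of_le_of_lt (b := ENNReal.ofReal (C ^ q * (a / (a - s)) ^ (p - 1))) ?_
    ENNReal.ofReal_lt_top
  refine iSup_le fun c => iSup_le fun r => iSup_le fun hr => ?_
  have hQ0 := volume_cube_ne_zero c hr
  have hQt := volume_cube_ne_top c hr
  have hWt := hw.wMeasure_cube_ne_top c hr
  have hV : 0 < volume.real (cube c r) := ENNReal.toReal_pos hQ0 hQt
  have hW : 0 < (wMeasure w).real (cube c r) := ENNReal.toReal_pos (hw.wMeasure_ne_zero hQ0) hWt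
  have hint := lintegral_rpow_le_of_weak (volume.restrict (cube c r)) (f := fun x => (g x)⁻¹)
    (ae_restrict_of_ae (hgpos.mono fun x hx => (inv_pos.2 hx).le)) hg.inv.aemeasurable hV.le
    (T := C ^ q * volume.real (cube c r) / (wMeasure w).real (cube c r)) (by positivity) hs0 hsa
    (by rw [Measure.restrict_apply_univ, ofReal_measureReal hQt])
    (fun t ht => volume_superlevel_inv_le hq hw hg hwg hC hwC c hr ht)
  have hcongr : ∫⁻ x in cube c r, ENNReal.ofReal (w x ^ (1 - p / (p - 1))) =
      ∫⁻ x in cube c r, ENNReal.ofReal ((g x)⁻¹ ^ s) := by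
    refine lintegral_congr_ae ?_
    filter_upwards [ae_restrict_of_ae hwg, ae_restrict_of_ae hgpos] with x hx hx0
    rw [hx, Real.inv_rpow hx0.le, ← Real.rpow_neg hx0.le]
    congr 2
    rw [hs]
    field_simp
    ring
  rw [hcongr]
  refine (mul_le_mul_right (ENNReal.rpow_le_rpow (ENNReal.div_le_div_right hint _) hp1.le) _).trans
    ?_
  rw [← ofReal_measureReal hQt, ← ofReal_measureReal hWt]
  set V := volume.real (cube c r)
  set W := (wMeasure w).real (cube c r)
  rw [← ENNReal.ofReal_div_of_pos hV, ← ENNReal.ofReal_div_of_pos hV,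
    ENNReal.ofReal_rpow_of_pos (by positivity), ← ENNReal.ofReal_mul (by positivity)]
  refine ENNReal.ofReal_le_ofReal (le_of_eq ?_)
  have hT : 0 < C ^ q * V / W := by positivity
  rw [mul_div_cancel_left₀ _ hV.ne', Real.mul_rpow (by positivity) (by positivity),
    ← Real.rpow_mul hT.le, hs, one_div_mul_cancel hp1.ne', Real.rpow_one]
  field_simp

/-- The power weight `‖x‖^{n(q-1)}` at the endpoint exponent for `A_q`. -/
def endpointWeight (n : ℕ) (q : ℝ) (x : Rn n) : ℝ := ‖x‖ ^ ((n : ℝ) * (q - 1))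

lemma isWeight_endpointWeight {n : ℕ} (hn : 0 < n) {q : ℝ} (hq : 1 < q) :
    IsWeight (endpointWeight n q) := by
  have : Nonempty (Fin n) := Fin.pos_iff_nonempty.mp hn
  have hq1 : 0 < q - 1 := by linarith
  refine ⟨Continuous.locallyIntegrable ?_, ?_⟩
  · exact continuous_norm.rpow_const fun x => Or.inr (by positivity)
  · filter_upwards [compl_mem_ae_iff.2 (measure_singleton (μ := (volume : Measure (Rn n))) 0)]
      with x hx
    exact Real.rpow_pos_of_pos (norm_pos_iff.2 hx) _

lemma lintegral_norm_rpow_neg_eq_top {n : ℕ} (hn : 0 < n) :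
    ∫⁻ x in cube (0 : Rn n) 1, ENNReal.ofReal (‖x‖ ^ (-(n : ℝ))) = ⊤ := by
  have : Nonempty (Fin n) := Fin.pos_iff_nonempty.mp hn
  by_contra hfin
  have hm : Measurable fun x : Rn n => ‖x‖ ^ (-(n : ℝ)) := measurable_norm.pow_const _
  have hint : IntegrableOn (fun x : Rn n => ‖x‖ ^ (-(n : ℝ))) (cube 0 1) :=
    (lintegral_ofReal_ne_top_iff_integrable hm.aestronglyMeasurable
      (Eventually.of_forall fun x => by positivity)).1 hfin
  have hball : IntegrableOn (fun x : Rn n => ‖x‖ ^ (-(n : ℝ))) (Metric.ball 0 1) :=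
    hint.mono_set (by
      rw [cube_eq_closedBall _ one_pos]
      exact Metric.ball_subset_closedBall)
  rw [← integrable_indicator_iff measurableSet_ball] at hball
  have hrad : (Metric.ball (0 : Rn n) 1).indicator (fun x : Rn n => ‖x‖ ^ (-(n : ℝ))) =
      fun x => (Iio (1 : ℝ)).indicator (fun t => t ^ (-(n : ℝ))) ‖x‖ := by
    ext x
    simp [indicator]
  rw [hrad, integrable_fun_norm_addHaar, Module.finrank_fin_fun] at hball
  have hIoo : IntegrableOn (fun t : ℝ => t ^ (-1 : ℝ)) (Ioo 0 1) := by
    refine (hball.mono_set Ioo_subset_Ioi_self).congr_fun (fun t ht => ?_) measurableSet_Ioo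
    have hn1 : ((n - 1 : ℕ) : ℝ) = n - 1 := by
      rw [Nat.cast_sub hn, Nat.cast_one]
    simp only [smul_eq_mul]
    rw [indicator_of_mem (show t ∈ Iio (1 : ℝ) from ht.2), ← Real.rpow_natCast,
      ← Real.rpow_add ht.1, hn1]
    congr 1
    ring
  exact lt_irrefl _ ((intervalIntegral.integrableOn_Ioo_rpow_iff one_pos).1 hIoo)

lemma AqConst_endpointWeight {n : ℕ} (hn : 0 < n) {q : ℝ} (hq : 1 < q) :
    AqConst q (endpointWeight n q) = ⊤ := by
  have hq1 : 0 < q - 1 := by linarith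
  have hQ0 := volume_cube_ne_zero (0 : Rn n) one_pos
  have hQt := volume_cube_ne_top (0 : Rn n) one_pos
  have hpow : ∀ x : Rn n, endpointWeight n q x ^ (1 - q / (q - 1)) = ‖x‖ ^ (-(n : ℝ)) := by
    intro x
    rw [endpointWeight, ← Real.rpow_mul (norm_nonneg x)]
    congr 1
    field_simp
    ring
  refine top_le_iff.1 (le_iSup_of_le 0 <| le_iSup_of_le 1 <| le_iSup_of_le one_pos ?_)
  simp only [hpow]
  rw [lintegral_norm_rpow_neg_eq_top hn, ENNReal.top_div_of_ne_top hQt,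
    ENNReal.top_rpow_of_pos hq1, ENNReal.mul_top]
  exact (ENNReal.div_pos ((isWeight_endpointWeight hn hq).wMeasure_ne_zero hQ0) hQt).ne'

lemma wMeasure_le_of_le {n : ℕ} {w : Rn n → ℝ} {E : Set (Rn n)} (hE : MeasurableSet E) {M : ℝ}
    (h : ∀ x ∈ E, w x ≤ M) : wMeasure w E ≤ ENNReal.ofReal M * volume E := by
  rw [wMeasure, withDensity_apply _ hE, ← setLIntegral_const]
  exact setLIntegral_mono' hE fun x hx => ENNReal.ofReal_le_ofReal (h x hx)

lemma le_wMeasure_of_le {n : ℕ} {w : Rn n → ℝ} {E : Set (Rn n)} (hE : MeasurableSet E) {M : ℝ}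
    (h : ∀ x ∈ E, M ≤ w x) : ENNReal.ofReal M * volume E ≤ wMeasure w E := by
  rw [wMeasure, withDensity_apply _ hE, ← setLIntegral_const]
  exact setLIntegral_mono' hE fun x hx => ENNReal.ofReal_le_ofReal (h x hx)

lemma AqRConst_endpointWeight_lt_top {n : ℕ} (hn : 0 < n) {q : ℝ} (hq : 1 < q) :
    AqRConst q (endpointWeight n q) < ⊤ := by
  have hq0 : 0 < q := by linarith
  have hq1 : 0 < q - 1 := by linarith
  have hn0 : (0 : ℝ) < n := by exact_mod_cast hn
  have hw := isWeight_endpointWeight hn hq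
  set m : ℝ := n * (q - 1) with hm
  have hm0 : 0 < m := by positivity
  have hpow : ∀ y : ℝ, 0 < y → y ^ m = (y ^ n) ^ (q - 1) := fun y hy => by
    rw [hm, Real.rpow_mul hy.le, Real.rpow_natCast]
  have hsplit : ∀ y : ℝ, 0 < y → y ^ q = y * y ^ (q - 1) := fun y hy => by
    rw [Real.rpow_sub_one hy.ne']; field_simp
  refine AqRConst_lt_top_of_bound hq0 hw (K := ENNReal.ofReal (2 * 3 ^ m * 2 ^ (q - 1)))
    ENNReal.ofReal_ne_top fun c r hr E hE hEQ hE0 => ?_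
  have hEt : volume E ≠ ⊤ := ne_top_of_le_ne_top (volume_cube_ne_top c hr) (measure_mono hEQ)
  have hVV : volume.real (cube c r) = (2 * r) ^ n := by
    rw [measureReal_def, volume_cube c hr, ENNReal.toReal_ofReal (by positivity)]
  have hv : 0 < volume.real E := ENNReal.toReal_pos hE0.ne' hEt
  have hvV : volume.real E ≤ (2 * r) ^ n := by
    rw [← hVV]
    exact measureReal_mono hEQ (volume_cube_ne_top c hr)
  have hdist : ∀ x ∈ cube c r, ‖x - c‖ ≤ r := fun x hx => by
    rw [cube_eq_closedBall c hr] at hx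
    exact mem_closedBall_iff_norm.1 hx
  -- It suffices to bound `w` from above on the cube and from below on a large part of `E`.
  have main : ∀ (M δ u : ℝ) (F : Set (Rn n)), 0 < M → 0 < δ → 0 < u → MeasurableSet F → F ⊆ E →
      ENNReal.ofReal u ≤ volume F →
      (∀ x ∈ cube c r, ‖x‖ ≤ M) → (∀ x ∈ F, δ ≤ ‖x‖) →
      volume.real E ^ q * (M ^ m * (2 * r) ^ n) ≤
        2 * 3 ^ m * 2 ^ (q - 1) * (((2 * r) ^ n) ^ q * (δ ^ m * u)) →
      volume E ^ q * wMeasure (endpointWeight n q) (cube c r) ≤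
        ENNReal.ofReal (2 * 3 ^ m * 2 ^ (q - 1)) *
          (volume (cube c r) ^ q * wMeasure (endpointWeight n q) E) := by
    intro M δ u F hM hδ hu hF hFE huF hup hlow hreal
    have h1 : wMeasure (endpointWeight n q) (cube c r) ≤
        ENNReal.ofReal (M ^ m) * volume (cube c r) :=
      wMeasure_le_of_le (measurableSet_cube c hr) fun x hx =>
        Real.rpow_le_rpow (norm_nonneg x) (hup x hx) hm0.le
    have h2 : ENNReal.ofReal (δ ^ m) * ENNReal.ofReal u ≤ wMeasure (endpointWeight n q) E :=
      calc _ ≤ ENNReal.ofReal (δ ^ m) * volume F := by gcongr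
        _ ≤ wMeasure (endpointWeight n q) F := le_wMeasure_of_le hF fun x hx =>
            Real.rpow_le_rpow hδ.le (hlow x hx) hm0.le
        _ ≤ _ := measure_mono hFE
    calc volume E ^ q * wMeasure (endpointWeight n q) (cube c r)
        ≤ volume E ^ q * (ENNReal.ofReal (M ^ m) * volume (cube c r)) := by gcongr
      _ = ENNReal.ofReal (volume.real E ^ q * (M ^ m * (2 * r) ^ n)) := by
          rw [volume_cube c hr, ← ofReal_measureReal hEt, ENNReal.ofReal_rpow_of_pos hv,
            ← ENNReal.ofReal_mul (by positivity), ← ENNReal.ofReal_mul (by positivity)]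
      _ ≤ ENNReal.ofReal (2 * 3 ^ m * 2 ^ (q - 1) * (((2 * r) ^ n) ^ q * (δ ^ m * u))) :=
          ENNReal.ofReal_le_ofReal hreal
      _ = ENNReal.ofReal (2 * 3 ^ m * 2 ^ (q - 1)) *
            (volume (cube c r) ^ q * (ENNReal.ofReal (δ ^ m) * ENNReal.ofReal u)) := by
          rw [volume_cube c hr, ENNReal.ofReal_rpow_of_pos (by positivity),
            ← ENNReal.ofReal_mul (by positivity), ← ENNReal.ofReal_mul (by positivity),
            ← ENNReal.ofReal_mul (by positivity)]
      _ ≤ _ := by gcongr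
  rcases le_or_gt ‖c‖ (2 * r) with hc | hc
  · -- The cube is close to the origin: discard from `E` a ball of half its volume.
    obtain ⟨δ, hδ, hδv⟩ : ∃ δ : ℝ, 0 < δ ∧ volume.real E = 2 * (2 * δ) ^ n := by
      refine ⟨(volume.real E / 2) ^ (n : ℝ)⁻¹ / 2, by positivity, ?_⟩
      rw [mul_div_cancel₀ _ (two_ne_zero), Real.rpow_inv_natCast_pow (by positivity) hn.ne']
      ring
    refine main (3 * r) δ ((2 * δ) ^ n) (E \ cube 0 δ) (by positivity) hδ (by positivity)
      (hE.diff (measurableSet_cube 0 hδ)) sdiff_subset ?_ (fun x hx => ?_) (fun x hx => ?_) ?_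
    · refine le_trans ?_ le_measure_sdiff
      rw [volume_cube 0 hδ, ← ofReal_measureReal hEt, hδv, ← ENNReal.ofReal_sub _ (by positivity)]
      exact ENNReal.ofReal_le_ofReal (by linarith)
    · have := norm_le_norm_add_norm_sub' x c
      have := hdist x hx
      linarith
    · have h := hx.2
      rw [cube_eq_closedBall 0 hδ, mem_closedBall_zero_iff, not_le] at h
      exact h.le
    · rw [hsplit _ hv, hsplit ((2 * r) ^ n) (by positivity), hpow (3 * r) (by positivity),
        hpow δ hδ, hpow 3 (by norm_num), hδv, mul_pow 2 δ, mul_pow 2 r, mul_pow 3 r]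
      rw [Real.mul_rpow (by positivity) (by positivity),
        Real.mul_rpow (by positivity) (by positivity),
        Real.mul_rpow (by positivity) (by positivity),
        Real.mul_rpow (by positivity) (by positivity)]
      exact le_of_eq (by ring)
  · -- The weight is essentially constant on a cube far from the origin.
    have hδ : 0 < ‖c‖ - r := by linarith
    refine main (‖c‖ + r) (‖c‖ - r) (volume.real E) E (by positivity) hδ hv hE Subset.rfl
      (ofReal_measureReal hEt).le (fun x hx => ?_) (fun x hx => ?_) ?_
    · have := norm_le_norm_add_norm_sub' x c
      have := hdist x hx
      linarith
    · have := norm_le_norm_add_norm_sub x c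
      have := hdist x (hEQ hx)
      linarith
    · have hA : (‖c‖ + r) ^ m ≤ 3 ^ m * (‖c‖ - r) ^ m := by
        rw [← Real.mul_rpow (by norm_num) hδ.le]
        exact Real.rpow_le_rpow (by positivity) (by linarith) hm0.le
      have hB : volume.real E ^ (q - 1) ≤ ((2 * r) ^ n) ^ (q - 1) :=
        Real.rpow_le_rpow hv.le hvV hq1.le
      have hC : (1 : ℝ) ≤ 2 * 2 ^ (q - 1) := by
        have := Real.one_le_rpow (x := 2) (by norm_num) hq1.le
        linarith
      rw [hsplit _ hv, hsplit ((2 * r) ^ n) (by positivity)]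
      calc volume.real E * volume.real E ^ (q - 1) * ((‖c‖ + r) ^ m * (2 * r) ^ n)
          ≤ volume.real E * ((2 * r) ^ n) ^ (q - 1) *
              (3 ^ m * (‖c‖ - r) ^ m * (2 * r) ^ n) := by gcongr
        _ = 1 * (volume.real E * ((2 * r) ^ n) ^ (q - 1) *
              (3 ^ m * (‖c‖ - r) ^ m * (2 * r) ^ n)) := (one_mul _).symm
        _ ≤ 2 * 2 ^ (q - 1) * (volume.real E * ((2 * r) ^ n) ^ (q - 1) *
              (3 ^ m * (‖c‖ - r) ^ m * (2 * r) ^ n)) := by gcongr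
        _ = _ := by ring

/-- For `q > 1` and `ε > 0`, `A_q ⊊ A_q^𝓡 ⊆ A_{q+ε}`. -/
theorem stmt2 (n : ℕ) (hn : 0 < n) (q ε : ℝ) (hq : 1 < q) (hε : 0 < ε) :
    {w : Rn n → ℝ | IsWeight w ∧ AqConst q w < ⊤} ⊂
        {w : Rn n → ℝ | IsWeight w ∧ AqRConst q w < ⊤} ∧
      {w : Rn n → ℝ | IsWeight w ∧ AqRConst q w < ⊤} ⊆
        {w : Rn n → ℝ | IsWeight w ∧ AqConst (q + ε) w < ⊤} := by
  refine ⟨⟨fun w hw => ⟨hw.1, AqRConst_lt_top_of_AqConst hq hw.1 hw.2⟩, fun hsub => ?_⟩,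
    fun w hw => ⟨hw.1, AqConst_lt_top_of_AqRConst hq (by linarith) hw.1 hw.2⟩⟩
  exact (hsub ⟨isWeight_endpointWeight hn hq, AqRConst_endpointWeight_lt_top hn hq⟩).2.ne
    (AqConst_endpointWeight hn hq)
end
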